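/- Let H be a Hausdorff topological group which is connected and simply connected, let G be a dense subgroup of H acting on H by left translation, and let V ⊆ H be open, path-connected and a G-covering (⋃_{g∈G} gV = H), with 1 ∈ V ⊆ X ⊆ ⋃_{s∈V} V·s⁻¹. Then the evaluation homomorphism ε : 𝐆(G, X ∩ G) → G, sending the class of a generator g ∈ E(X ∩ G) to g, is an isomorphism; in particular 𝐆(G, X ∩ G) (the universal group of the inverse semigroup Γ(X,G,H)) is isomorphic to G. -/

import Mathlib

open Pointwise

/-- `E(V) = {g ∈ G : V ∩ g•V ≠ ∅}`. -/
def Eset (G : Type*) {M : Type*} [Group G] [MulAction G M] (V : Set M) : Set G :=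
  {g | (V ∩ g • V).Nonempty}

/-- `F'(V) = {(g,h) : V ∩ g•V ∩ (g*h)•V ≠ ∅}`. -/
def Fset (G : Type*) {M : Type*} [Group G] [MulAction G M] (V : Set M) : Set (G × G) :=
  {p | (V ∩ p.1 • V ∩ (p.1 * p.2) • V).Nonempty}

/-- The relators `(g)(h)((g*h))⁻¹` with `(g,h) ∈ F'(V)`. -/
def relatorSet (G : Type*) {M : Type*} [Group G] [MulAction G M] (V : Set M) :
    Set (FreeGroup ↥(Eset G V)) :=
  {r | ∃ g h gh : ↥(Eset G V), ((g : G), (h : G)) ∈ Fset G V ∧ (gh : G) = (g : G) * h ∧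
       r = FreeGroup.of g * FreeGroup.of h * (FreeGroup.of gh)⁻¹}

/-- The group `𝐆(G,V)`: the free group on `E(V)` modulo the normal closure of the relators. -/
abbrev GGrp (G : Type*) {M : Type*} [Group G] [MulAction G M] (V : Set M) : Type _ :=
  FreeGroup ↥(Eset G V) ⧸ Subgroup.normalClosure (relatorSet G V)

/-- The class of a generator `g ∈ E(V)` in `𝐆(G,V)`. -/
def GGrp.gen (G : Type*) {M : Type*} [Group G] [MulAction G M] (V : Set M)
    (g : ↥(Eset G V)) : GGrp G V :=
  QuotientGroup.mk (FreeGroup.of g)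

theorem Eset_mono {G M : Type*} [Group G] [MulAction G M] {U V : Set M} (h : U ⊆ V) :
    Eset G U ⊆ Eset G V := by
  rintro g ⟨x, hx1, hx2⟩
  exact ⟨x, h hx1, Set.smul_set_mono h hx2⟩

theorem Fset_mono {G M : Type*} [Group G] [MulAction G M] {U V : Set M} (h : U ⊆ V) :
    Fset G U ⊆ Fset G V := by
  rintro ⟨g, g'⟩ ⟨x, ⟨hx1, hx2⟩, hx3⟩
  exact ⟨x, ⟨h hx1, Set.smul_set_mono h hx2⟩, Set.smul_set_mono h hx3⟩

/-- `ψ_U^V : 𝐆(G,U) → 𝐆(G,V)`, induced on generators by the inclusion `E(U) ⊆ E(V)`. -/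
def psi (G : Type*) {M : Type*} [Group G] [MulAction G M] {U V : Set M} (hUV : U ⊆ V) :
    GGrp G U →* GGrp G V :=
  QuotientGroup.lift _
    ((QuotientGroup.mk' (Subgroup.normalClosure (relatorSet G V))).comp
      (FreeGroup.map (fun g => (⟨(g : G), Eset_mono hUV g.2⟩ : ↥(Eset G V))))) <| by
    intro x hx
    set φ := (QuotientGroup.mk' (Subgroup.normalClosure (relatorSet G V))).comp
      (FreeGroup.map (fun g : ↥(Eset G U) => (⟨(g : G), Eset_mono hUV g.2⟩ : ↥(Eset G V))))
    have hsub : relatorSet G U ⊆ (φ.ker : Set (FreeGroup ↥(Eset G U))) := by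
      rintro r ⟨g, h, gh, hF, hmul, rfl⟩
      have : φ (FreeGroup.of g * FreeGroup.of h * (FreeGroup.of gh)⁻¹) = 1 := by
        simp only [φ, MonoidHom.comp_apply, map_mul, map_inv, FreeGroup.map.of]
        apply (QuotientGroup.eq_one_iff _).mpr
        apply Subgroup.subset_normalClosure
        exact ⟨_, _, _, Fset_mono hUV hF, hmul, rfl⟩
      exact this
    exact (Subgroup.normalClosure_le_normal hsub) hx

@[simp] theorem psi_gen {G M : Type*} [Group G] [MulAction G M] {U V : Set M} (hUV : U ⊆ V)
    (g : ↥(Eset G U)) :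
    psi G hUV (GGrp.gen G U g) = GGrp.gen G V ⟨(g : G), Eset_mono hUV g.2⟩ := rfl

/-- The evaluation homomorphism `ε_V : 𝐆(G,V) → G`. -/
def evalHom (G : Type*) {M : Type*} [Group G] [MulAction G M] (V : Set M) :
    GGrp G V →* G :=
  QuotientGroup.lift _ (FreeGroup.lift (fun g : ↥(Eset G V) => (g : G))) <| by
    intro x hx
    have hsub : relatorSet G V ⊆
        ((FreeGroup.lift (fun g : ↥(Eset G V) => (g : G))).ker :
          Set (FreeGroup ↥(Eset G V))) := by
      rintro r ⟨g, h, gh, hF, hmul, rfl⟩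
      have : FreeGroup.lift (fun g : ↥(Eset G V) => (g : G))
          (FreeGroup.of g * FreeGroup.of h * (FreeGroup.of gh)⁻¹) = 1 := by
        rw [map_mul, map_mul, map_inv, FreeGroup.lift_apply_of, FreeGroup.lift_apply_of,
          FreeGroup.lift_apply_of, hmul]
        group
      exact this
    exact (Subgroup.normalClosure_le_normal hsub) hx

@[simp] theorem evalHom_gen {G M : Type*} [Group G] [MulAction G M] (V : Set M)
    (g : ↥(Eset G V)) : evalHom G V (GGrp.gen G V g) = (g : G) := by
  simp [evalHom, GGrp.gen, FreeGroup.lift_apply_of]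


section Covering

/-- Over a simply connected base, a covering map is injective on path components. -/
theorem IsCoveringMap.eq_of_joined {E X : Type*} [TopologicalSpace E] [TopologicalSpace X]
    [SimplyConnectedSpace X] {p : E → X} (cov : IsCoveringMap p) {e e' : E} (h : Joined e e')
    (hp : p e = p e') : e = e' := by
  obtain ⟨Γ⟩ := h
  have hΓ : Γ.toContinuousMap = cov.liftPath ((Γ.map cov.continuous).cast rfl hp) e (by simp) :=
    (cov.eq_liftPath_iff' _).mpr ⟨rfl, Γ.source⟩
  have hend := cov.liftPath_apply_one_eq_of_homotopicRel
    (SimplyConnectedSpace.paths_homotopic ((Γ.map cov.continuous).cast rfl hp) (Path.refl (p e)))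
    e (by simp) (by simp)
  have hrefl : cov.liftPath (Path.refl (p e)) e (by simp) 1 = e :=
    DFunLike.congr_fun (cov.liftPath_const (e := e) rfl) 1
  have hΓ1 : e' = _ := Γ.target.symm.trans (DFunLike.congr_fun hΓ 1)
  exact ((hΓ1.trans hend).trans hrefl).symm

/-- Over a path-connected base, every path component of a covering space meets every fibre. -/
theorem IsCoveringMap.exists_joined {E X : Type*} [TopologicalSpace E] [TopologicalSpace X]
    [PathConnectedSpace X] {p : E → X} (cov : IsCoveringMap p) (e : E) (x : X) :
    ∃ e', Joined e e' ∧ p e' = x := by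
  obtain ⟨γ⟩ := PathConnectedSpace.joined (p e) x
  refine ⟨cov.liftPath γ e γ.source 1, ⟨⟨cov.liftPath γ e γ.source, cov.liftPath_zero .., rfl⟩⟩, ?_⟩
  exact (congrFun (cov.liftPath_lifts γ e γ.source) 1).trans γ.target

/-- The principal bundle with discrete fibre `A` glued from a locally constant cocycle. -/
def cocycleBundleCore {ι M A : Type*} [TopologicalSpace M] [Group A] [TopologicalSpace A]
    [DiscreteTopology A] {U : ι → Set M} (hopen : ∀ i, IsOpen (U i)) (idx : M → ι)
    (hidx : ∀ x, x ∈ U (idx x)) (c : ι → ι → A)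
    (hc : ∀ i j k, (U i ∩ U j ∩ U k).Nonempty → c k j * c j i = c k i) :
    FiberBundleCore ι M A where
  baseSet := U
  isOpen_baseSet := hopen
  indexAt := idx
  mem_baseSet_at := hidx
  coordChange i j _ a := c j i * a
  coordChange_self i x hx a := by simpa using hc i i i ⟨x, ⟨hx, hx⟩, hx⟩
  continuousOn_coordChange i j :=
    (continuous_of_discreteTopology.comp continuous_snd).continuousOn
  coordChange_comp i j k x hx a := by rw [← mul_assoc, hc i j k ⟨x, hx⟩]

/-- A locally constant cocycle on a cover of a simply connected space by path-connected open sets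
is a coboundary. -/
theorem exists_coboundary_of_cocycle {ι M A : Type*} [TopologicalSpace M]
    [SimplyConnectedSpace M] [Group A] {U : ι → Set M} (hopen : ∀ i, IsOpen (U i))
    (hpc : ∀ i, IsPathConnected (U i)) (hcov : ∀ x, ∃ i, x ∈ U i) (c : ι → ι → A)
    (hc : ∀ i j k, (U i ∩ U j ∩ U k).Nonempty → c k j * c j i = c k i) :
    ∃ b : ι → A, ∀ i j, (U i ∩ U j).Nonempty → b j = c j i * b i := by
  let : TopologicalSpace A := ⊥
  have : DiscreteTopology A := ⟨rfl⟩
  choose idx hidx using hcov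
  let Z := cocycleBundleCore hopen idx hidx c hc
  have cov : IsCoveringMap Z.proj := FiberBundle.isCoveringMap (F := A) (E := Z.Fiber)
  obtain ⟨x₀⟩ := (inferInstance : Nonempty M)
  let e₀ : Z.TotalSpace := ⟨x₀, (1 : A)⟩
  choose s hs hps using cov.exists_joined e₀
  let coord (i : ι) (x : M) : A := (Z.localTriv i (s x)).2
  have coord_const (i : ι) {x y : M} (hx : x ∈ U i) (hy : y ∈ U i) : coord i x = coord i y := by
    let e : M → Z.TotalSpace := fun z => (Z.localTriv i).toOpenPartialHomeomorph.symm (z, coord i x)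
    have hex : e x = s x := by
      have := (Z.localTriv i).symm_apply_mk_proj (x := s x)
        ((Z.localTriv i).mem_source.2 (by rw [hps]; exact hx))
      rwa [hps] at this
    have hj : Joined (e x) (e y) :=
      ((hpc i).joinedIn x hx y hy).map_continuousOn
        (Z.localTriv i).continuousOn_symm_prodMk_left |>.joined
    have hpe : Z.proj (e y) = y := (Z.localTriv i).proj_symm_apply' hy
    have hey : e y = s y := cov.eq_of_joined
      ((hex ▸ hj).symm.trans ((hs x).symm.trans (hs y))) (hpe.trans (hps y).symm)
    have : Z.localTriv i (e y) = (y, coord i x) := (Z.localTriv i).apply_symm_apply' hy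
    rw [hey] at this
    exact (congrArg Prod.snd this).symm
  choose pt hpt using fun i => (hpc i).nonempty
  refine ⟨fun i => coord i (pt i), fun i j => ?_⟩
  rintro ⟨x, hxi, hxj⟩
  dsimp only
  rw [coord_const i (hpt i) hxi, coord_const j (hpt j) hxj]
  have hx : (s x).1 = x := hps x
  exact (Z.coordChange_comp (Z.indexAt (s x).1) i j (s x).1
    ⟨⟨Z.mem_baseSet_at _, hx.symm ▸ hxi⟩, hx.symm ▸ hxj⟩ (s x).2).symm

end Covering

section GGrp

variable {G M : Type*} [Group G] [MulAction G M]

theorem mem_Eset_iff {V : Set M} {g : G} : g ∈ Eset G V ↔ ∃ v ∈ V, g • v ∈ V := by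
  constructor
  · rintro ⟨_, hx, v, hv, rfl⟩
    exact ⟨v, hv, hx⟩
  · rintro ⟨v, hv, hx⟩
    exact ⟨g • v, hx, v, hv, rfl⟩

theorem mem_Fset_of_mem_smul {V : Set M} {x : M} {i j k : G} (hi : x ∈ i • V) (hj : x ∈ j • V)
    (hk : x ∈ k • V) : (k⁻¹ * j, j⁻¹ * i) ∈ Fset G V := by
  refine ⟨k⁻¹ • x, ⟨Set.mem_smul_set_iff_inv_smul_mem.1 hk, ?_⟩, ?_⟩
  · simpa only [mul_smul] using Set.smul_mem_smul_set (a := k⁻¹) hj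
  · simpa only [mul_assoc, mul_inv_cancel_left, mul_smul] using
      Set.smul_mem_smul_set (a := k⁻¹) hi

theorem Eset_subset_of_Fset_subset {V W : Set M} (h : Fset G V ⊆ Fset G W) :
    Eset G V ⊆ Eset G W := by
  rintro g ⟨x, hx, hgx⟩
  have : (g, (1 : G)) ∈ Fset G W := h ⟨x, ⟨hx, hgx⟩, by simpa using hgx⟩
  exact this.mono Set.inter_subset_left

open Classical in
/-- The class of `g` in `𝐆(G,V)`, extended by `1` outside `E(V)`. -/
noncomputable def GGrp.genOf (V : Set M) (g : G) : GGrp G V :=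
  if h : g ∈ Eset G V then GGrp.gen G V ⟨g, h⟩ else 1

theorem GGrp.genOf_of_mem {V : Set M} {g : G} (h : g ∈ Eset G V) :
    GGrp.genOf V g = GGrp.gen G V ⟨g, h⟩ :=
  dif_pos h

theorem GGrp.genOf_mul {V : Set M} {g h : G} (hF : (g, h) ∈ Fset G V) :
    GGrp.genOf V g * GGrp.genOf V h = GGrp.genOf V (g * h) := by
  obtain ⟨x, ⟨hx, hgx⟩, hghx⟩ := id hF
  have hg : g ∈ Eset G V := ⟨x, hx, hgx⟩
  have hgh : g * h ∈ Eset G V := ⟨x, hx, hghx⟩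
  have hh : h ∈ Eset G V := by
    refine ⟨g⁻¹ • x, Set.mem_smul_set_iff_inv_smul_mem.1 hgx, ?_⟩
    simpa only [mul_smul, inv_smul_smul] using Set.smul_mem_smul_set (a := g⁻¹) hghx
  rw [genOf_of_mem hg, genOf_of_mem hh, genOf_of_mem hgh, ← mul_inv_eq_one]
  exact (QuotientGroup.eq_one_iff _).mpr
    (Subgroup.subset_normalClosure ⟨⟨g, hg⟩, ⟨h, hh⟩, ⟨g * h, hgh⟩, hF, rfl, rfl⟩)

theorem GGrp.genOf_one {V : Set M} (hV : V.Nonempty) : GGrp.genOf V (1 : G) = 1 := by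
  obtain ⟨x, hx⟩ := hV
  have h : ((1 : G), (1 : G)) ∈ Fset G V := ⟨x, by simpa using hx⟩
  simpa using GGrp.genOf_mul h

theorem GGrp.genOf_inv {V : Set M} {g : G} (hg : g ∈ Eset G V) :
    GGrp.genOf V g⁻¹ = (GGrp.genOf V g)⁻¹ := by
  obtain ⟨x, hx, hgx⟩ := hg
  have h : (g, g⁻¹) ∈ Fset G V := ⟨x, ⟨hx, hgx⟩, by simpa using hx⟩
  have := GGrp.genOf_mul h
  rw [mul_inv_cancel, GGrp.genOf_one ⟨x, hx⟩] at this
  exact eq_inv_of_mul_eq_one_right this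

/-- A map `d : G → 𝐆(G,W)` compatible with right multiplication by the generators is a left
inverse of the evaluation homomorphism. -/
theorem leftInverse_evalHom {W : Set M} {d : G → GGrp G W} (h1 : d 1 = 1)
    (hd : ∀ g, ∀ k ∈ Eset G W, d (g * k) = d g * GGrp.genOf W k) :
    Function.LeftInverse d (evalHom G W) := by
  have key (a : FreeGroup (Eset G W)) : ∀ g, d (g * evalHom G W a) = d g * (a : GGrp G W) := by
    induction a using FreeGroup.induction_on with
    | C1 => simp
    | of k =>
      intro g
      have := hd g k k.2
      rw [GGrp.genOf_of_mem k.2] at this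
      exact (congrArg (fun x => d (g * x)) (evalHom_gen W k)).trans this
    | inv_of k ih =>
      intro g
      have := ih (g * (evalHom G W (FreeGroup.of k : GGrp G W))⁻¹)
      rw [inv_mul_cancel_right] at this
      rw [QuotientGroup.mk_inv, map_inv, this, mul_inv_cancel_right]
    | mul a b iha ihb =>
      intro g
      rw [QuotientGroup.mk_mul, map_mul, ← mul_assoc, ihb, iha, mul_assoc]
  intro a
  induction a using QuotientGroup.induction_on with
  | H a => simpa [h1] using key a 1

variable [TopologicalSpace M] [ContinuousConstSMul G M]

theorem exists_lift_of_Fset_subset [SimplyConnectedSpace M] {V W : Set M} (hopen : IsOpen V)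
    (hpc : IsPathConnected V) (hcov : ⋃ g : G, g • V = Set.univ) (hF : Fset G V ⊆ Fset G W) :
    ∃ d : G → GGrp G W, d 1 = 1 ∧
      ∀ g, ∀ k ∈ Eset G V, d (g * k) = d g * GGrp.genOf W k := by
  obtain ⟨b, hb⟩ := exists_coboundary_of_cocycle (U := fun g : G => g • V)
    (fun g => hopen.smul g) (fun g => hpc.image (continuous_const_smul g))
    (fun x => Set.mem_iUnion.1 (hcov ▸ Set.mem_univ x)) (fun k j => GGrp.genOf W (k⁻¹ * j))
    (by
      rintro i j k ⟨x, ⟨hi, hj⟩, hk⟩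
      rw [GGrp.genOf_mul (hF (mem_Fset_of_mem_smul hi hj hk))]
      group)
  refine ⟨fun g => b 1 * (b g)⁻¹, mul_inv_cancel _, fun g k hk => ?_⟩
  have hne : (g • V ∩ (g * k) • V).Nonempty := by
    obtain ⟨x, hx, hkx⟩ := id hk
    exact ⟨g • x, Set.smul_mem_smul_set hx, by
      simpa only [mul_smul] using Set.smul_mem_smul_set (a := g) hkx⟩
  have hkg : (g * k)⁻¹ * g = k⁻¹ := by group
  dsimp only
  rw [hb g (g * k) hne, hkg, GGrp.genOf_inv (Eset_subset_of_Fset_subset hF hk), mul_inv_rev,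
    inv_inv, mul_assoc]

theorem evalHom_surjective [PreconnectedSpace M] {V W : Set M} (hopen : IsOpen V)
    (hne : V.Nonempty) (hcov : ⋃ g : G, g • V = Set.univ) (hE : Eset G V ⊆ Eset G W) :
    Function.Surjective (evalHom G W) := by
  set R := (evalHom G W).range
  have hER {g : G} (hg : g ∈ Eset G V) : g ∈ R := ⟨GGrp.gen G W ⟨g, hE hg⟩, evalHom_gen ..⟩
  have hR {g r : G} (hr : r ∈ R) (h : (g • V ∩ r • V).Nonempty) : g ∈ R := by
    obtain ⟨x, hg, hr'⟩ := h
    have : r⁻¹ * g ∈ Eset G V := ⟨r⁻¹ • x, Set.mem_smul_set_iff_inv_smul_mem.1 hr', by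
      simpa only [mul_smul] using Set.smul_mem_smul_set (a := r⁻¹) hg⟩
    simpa using R.mul_mem hr (hER this)
  have hclopen : IsClopen (⋃ r ∈ R, r • V) := by
    refine ⟨⟨?_⟩, isOpen_biUnion fun r _ => hopen.smul r⟩
    convert! (isOpen_biUnion fun (g : G) (_ : g ∉ R) => hopen.smul g) using 1
    ext x
    simp only [Set.mem_compl_iff, Set.mem_iUnion, exists_prop]
    constructor
    · intro hx
      obtain ⟨g, hg⟩ := Set.mem_iUnion.1 (hcov ▸ Set.mem_univ x)
      exact ⟨g, fun hgR => hx ⟨g, hgR, hg⟩, hg⟩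
    · rintro ⟨g, hgR, hg⟩ ⟨r, hr, hx⟩
      exact hgR (hR hr ⟨x, hg, hx⟩)
  obtain ⟨v, hv⟩ := hne
  have huniv := hclopen.eq_univ ⟨(1 : G) • v,
    Set.mem_biUnion R.one_mem (Set.smul_mem_smul_set hv)⟩
  intro g
  have hg : g • v ∈ ⋃ r ∈ R, r • V := huniv ▸ Set.mem_univ _
  obtain ⟨r, hr, hx⟩ := Set.mem_iUnion₂.1 hg
  exact hR hr ⟨g • v, Set.smul_mem_smul_set hv, hx⟩

end GGrp

section DenseSubgroup

variable {H : Type*} [Group H] {G : Subgroup H}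

theorem smul_inter_coe_subgroup (g : G) (V : Set H) :
    g • (V ∩ (G : Set H)) = g • V ∩ (G : Set H) := by
  rw [Set.smul_set_inter]
  congr 1
  ext x
  rw [Set.mem_smul_set_iff_inv_smul_mem]
  exact G.mul_mem_cancel_left (g⁻¹).2

theorem Fset_subset_Fset_inter_of_dense [TopologicalSpace H] [IsTopologicalGroup H]
    (hdense : Dense (G : Set H)) {V : Set H} (hopen : IsOpen V) :
    Fset G V ⊆ Fset G (V ∩ (G : Set H)) := by
  rintro ⟨g, h⟩ hF
  obtain ⟨x, ⟨⟨h1, h2⟩, h3⟩, hG⟩ := hdense.inter_open_nonempty _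
    ((hopen.inter (hopen.smul g)).inter (hopen.smul (g * h))) hF
  refine ⟨x, ⟨⟨h1, hG⟩, ?_⟩, ?_⟩
  · rw [smul_inter_coe_subgroup]; exact ⟨h2, hG⟩
  · rw [smul_inter_coe_subgroup]; exact ⟨h3, hG⟩

theorem GGrp.genOf_mul_inv {X : Set H} (h1 : 1 ∈ X) {x y : G} (hx : (x : H) ∈ X)
    (hy : (y : H) ∈ X) :
    GGrp.genOf (X ∩ (G : Set H)) (x * y⁻¹) =
      GGrp.genOf (X ∩ (G : Set H)) x * (GGrp.genOf (X ∩ (G : Set H)) y)⁻¹ := by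
  have h1' : (1 : H) ∈ X ∩ (G : Set H) := ⟨h1, G.one_mem⟩
  have mem {z : G} (hz : (z : H) ∈ X) : z ∈ Eset G (X ∩ (G : Set H)) :=
    mem_Eset_iff.2 ⟨1, h1', by simpa [Subgroup.smul_def] using hz⟩
  have hF : (x, y⁻¹) ∈ Fset G (X ∩ (G : Set H)) := by
    refine ⟨x, ⟨⟨hx, x.2⟩, 1, h1', ?_⟩, y, ⟨hy, y.2⟩, ?_⟩ <;> simp [Subgroup.smul_def]
  rw [← GGrp.genOf_mul hF, GGrp.genOf_inv (mem hy)]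

end DenseSubgroup

/-- Main theorem on `Γ(X,G,H)`: if `H` is Hausdorff, connected and simply connected, `G ≤ H`
is dense, `V` is open, path-connected, a `G`-covering, and `1 ∈ V ⊆ X ⊆ ⋃_{s∈V} V·s⁻¹`, then
the evaluation homomorphism `𝐆(G, X ∩ G) → G` is an isomorphism; in particular the universal
group of `Γ(X,G,H)`, namely `𝐆(G, X ∩ G)`, is isomorphic to `G`. -/
theorem eval_iso_of_model_data {H : Type*} [TopologicalSpace H] [Group H]
    [IsTopologicalGroup H] [T2Space H] [ConnectedSpace H] [SimplyConnectedSpace H]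
    (G : Subgroup H) (hdense : Dense (G : Set H))
    {V X : Set H} (hVopen : IsOpen V) (hVpc : IsPathConnected V)
    (hcov : (⋃ g : ↥G, g • V) = (Set.univ : Set H))
    (h1V : (1 : H) ∈ V) (hVX : V ⊆ X)
    (hX : X ⊆ {x : H | ∃ v ∈ V, ∃ s ∈ V, x = v * s⁻¹}) :
    Function.Bijective (evalHom ↥G (X ∩ (G : Set H))) := by
  set W := X ∩ (G : Set H)
  have hF : Fset G V ⊆ Fset G W := (Fset_subset_Fset_inter_of_dense hdense hVopen).trans
    (Fset_mono (Set.inter_subset_inter_left _ hVX))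
  refine ⟨?_, evalHom_surjective hVopen ⟨1, h1V⟩ hcov (Eset_subset_of_Fset_subset hF)⟩
  obtain ⟨d, h1, hd⟩ := exists_lift_of_Fset_subset hVopen hVpc hcov hF
  have mem_E {x : G} (hx : (x : H) ∈ X) : x ∈ Eset G V := by
    obtain ⟨v, hv, s, hs, hvs⟩ := hX hx
    exact mem_Eset_iff.2 ⟨s, hs, by simpa [Subgroup.smul_def, hvs] using hv⟩
  refine (leftInverse_evalHom h1 fun g k hk => ?_).injective
  obtain ⟨y, ⟨hy, hyG⟩, hx, hxG⟩ := mem_Eset_iff.1 hk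
  lift y to G using hyG
  obtain ⟨x, rfl⟩ : ∃ x : G, x * y⁻¹ = k := ⟨k * y, mul_inv_cancel_right _ _⟩
  have hx : (x : H) ∈ X := by simpa [Subgroup.smul_def] using hx
  have hdx := hd (g * (x * y⁻¹)) y (mem_E hy)
  rw [mul_assoc, inv_mul_cancel_right, hd g x (mem_E hx)] at hdx
  rw [GGrp.genOf_mul_inv (hVX h1V) hx hy, ← mul_assoc (d g), hdx, mul_inv_cancel_right]
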